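/- Let A_1, A_2, A_3 be n×n quaternion Hermitian matrices and let X be an n×n quaternion Hermitian positive semidefinite matrix of rank r ≥ 1. Suppose X admits a decomposition X = Σ_{i=1}^r u_i u_iᴴ with u_iᴴ A_k u_i = (A_k • X)/r for all i = 1,…,r and k = 1, 2. Then X admits a decomposition X = Σ_{i=1}^r v_i v_iᴴ with v_iᴴ A_k v_i = (A_k • X)/r for all i = 1,…,r and k = 1, 2, 3. -/

import Mathlib

open Matrix Quaternion BigOperators

/-- The quadratic form `xᴴ A x` of a quaternion matrix. -/
noncomputable def qform {n : ℕ} (A : Matrix (Fin n) (Fin n) ℍ[ℝ]) (x : Fin n → ℍ[ℝ]) : ℍ[ℝ] :=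
  star x ⬝ᵥ A.mulVec x

/-- The inner product `A • B = Re (tr (Aᴴ B))` of quaternion matrices. -/
noncomputable def qdot {n : ℕ} (A B : Matrix (Fin n) (Fin n) ℍ[ℝ]) : ℝ :=
  (Matrix.trace (Aᴴ * B)).re

/-- A quaternion matrix is Hermitian positive semidefinite:
it is Hermitian and `xᴴ X x ≥ 0` for all `x`. -/
def qPSD {n : ℕ} (X : Matrix (Fin n) (Fin n) ℍ[ℝ]) : Prop :=
  X.IsHermitian ∧ ∀ x : Fin n → ℍ[ℝ], 0 ≤ (star x ⬝ᵥ X.mulVec x).re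

/-- `X` can be written as a sum of `r` quaternion rank-one outer products. -/
def qDecomp {n : ℕ} (X : Matrix (Fin n) (Fin n) ℍ[ℝ]) (r : ℕ) : Prop :=
  ∃ v : Fin r → (Fin n → ℍ[ℝ]), X = ∑ i, vecMulVec (v i) (star (v i))

/-- `X` has rank `r`: `r` is the least number of rank-one terms summing to `X`. -/
def qRank {n : ℕ} (X : Matrix (Fin n) (Fin n) ℍ[ℝ]) (r : ℕ) : Prop :=
  qDecomp X r ∧ ∀ s : ℕ, qDecomp X s → r ≤ s

/-- The linear functional `B ↦ A • B`. -/
noncomputable def qdotLin {n : ℕ} (A : Matrix (Fin n) (Fin n) ℍ[ℝ]) :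
    Matrix (Fin n) (Fin n) ℍ[ℝ] →ₗ[ℝ] ℝ where
  toFun := qdot A
  map_add' B C := by simp [qdot, Matrix.mul_add]
  map_smul' c B := by simp [qdot]

@[simp]
lemma qdotLin_apply {n : ℕ} (A B : Matrix (Fin n) (Fin n) ℍ[ℝ]) : qdotLin A B = qdot A B := rfl

/-- The outer product `x xᴴ`. -/
noncomputable def outer {n : ℕ} (x : Fin n → ℍ[ℝ]) : Matrix (Fin n) (Fin n) ℍ[ℝ] :=
  vecMulVec x (star x)

lemma Quaternion.re_mul_comm (a b : ℍ[ℝ]) : (a * b).re = (b * a).re := by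
  simp only [Quaternion.re_mul]; ring

lemma Quaternion.re_sum {ι : Type*} (s : Finset ι) (f : ι → ℍ[ℝ]) :
    (∑ i ∈ s, f i).re = ∑ i ∈ s, (f i).re :=
  map_sum (AddMonoidHom.mk' (fun q : ℍ[ℝ] => q.re) Quaternion.re_add) f s

lemma star_qform {n : ℕ} {A : Matrix (Fin n) (Fin n) ℍ[ℝ]} (hA : A.IsHermitian)
    (x : Fin n → ℍ[ℝ]) : star (qform A x) = qform A x := by
  rw [qform, ← Matrix.star_dotProduct, Matrix.star_mulVec, hA.eq,
    ← Matrix.dotProduct_mulVec]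

lemma qform_re {n : ℕ} {A : Matrix (Fin n) (Fin n) ℍ[ℝ]} (hA : A.IsHermitian)
    (x : Fin n → ℍ[ℝ]) : (qform A x).re = qdot A (outer x) := by
  rw [qform, qdot, outer, hA.eq, Matrix.mul_vecMulVec, Matrix.trace_vecMulVec]
  simp only [dotProduct, Quaternion.re_sum]
  exact Finset.sum_congr rfl fun i _ => Quaternion.re_mul_comm _ _

lemma qform_eq_coe {n : ℕ} {A : Matrix (Fin n) (Fin n) ℍ[ℝ]} (hA : A.IsHermitian)
    (x : Fin n → ℍ[ℝ]) : qform A x = ((qdot A (outer x) : ℝ) : ℍ[ℝ]) := by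
  rw [← qform_re hA]
  exact Quaternion.star_eq_self.mp (star_qform hA x)

/-- The cross term `u q̄ wᴴ + w q uᴴ`, as a real-linear function of `q`. -/
noncomputable def crossTerm {n : ℕ} (u w : Fin n → ℍ[ℝ]) :
    ℍ[ℝ] →ₗ[ℝ] Matrix (Fin n) (Fin n) ℍ[ℝ] where
  toFun q := Matrix.of fun i j => u i * star q * star (w j) + w i * q * star (u j)
  map_add' p q := by
    ext1 i j
    simp only [Matrix.of_apply, Matrix.add_apply, star_add, mul_add, add_mul]
    abel
  map_smul' c q := by
    ext1 i j
    simp [smul_add]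

lemma outer_smul {n : ℕ} (c : ℝ) (x : Fin n → ℍ[ℝ]) : outer (c • x) = c ^ 2 • outer x := by
  ext1 i j
  simp [outer, vecMulVec_apply, smul_smul, pow_two]

lemma outer_add_mul {n : ℕ} (u w : Fin n → ℍ[ℝ]) (q : ℍ[ℝ]) :
    outer (fun i => u i + w i * q) = outer u + normSq q • outer w + crossTerm u w q := by
  ext1 i j
  have h : w i * q * star q * star (w j) = normSq q • (w i * star (w j)) := by
    rw [mul_assoc (w i), Quaternion.self_mul_star, Quaternion.mul_coe_eq_smul, smul_mul_assoc]
  simp only [outer, crossTerm, vecMulVec_apply, Pi.star_apply, star_add, star_mul,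
    LinearMap.coe_mk, AddHom.coe_mk, Matrix.add_apply, Matrix.smul_apply, Matrix.of_apply,
    mul_add, add_mul, ← mul_assoc, h]
  abel

lemma crossTerm_swap {n : ℕ} (u w : Fin n → ℍ[ℝ]) (q : ℍ[ℝ]) :
    crossTerm w u (-star q) = -crossTerm u w q := by
  ext1 i j
  simp [crossTerm, add_comm]

/-- Real quadratics whose end coefficients have opposite signs have a root. -/
lemma exists_quadratic_root {a b c : ℝ} (ha : a < 0) (hc : 0 < c) :
    ∃ t : ℝ, a * (t * t) + b * t + c = 0 := by
  have hd : 0 ≤ discrim a b c := by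
    unfold discrim
    nlinarith [sq_nonneg b, mul_pos (neg_pos.mpr ha) hc]
  exact exists_quadratic_eq_zero ha.ne ⟨_, (Real.mul_self_sqrt hd).symm⟩

/-- A nonzero quaternion annihilated by two given real functionals. -/
lemma exists_ne_zero_of_two_functionals (f g : ℍ[ℝ] →ₗ[ℝ] ℝ) :
    ∃ q : ℍ[ℝ], q ≠ 0 ∧ f q = 0 ∧ g q = 0 := by
  have h : LinearMap.ker (f.prod g) ≠ ⊥ := by
    apply LinearMap.ker_ne_bot_of_finrank_lt
    rw [Quaternion.finrank_eq_four, Module.finrank_prod]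
    simp
  obtain ⟨q, hq, hq0⟩ := (Submodule.ne_bot_iff _).mp h
  exact ⟨q, hq0, congrArg Prod.fst hq, congrArg Prod.snd hq⟩

/-- Two vectors on which two functionals agree can be rotated into one another so that the two
values are kept and a third functional takes a prescribed intermediate value. -/
lemma exists_pair_rotation {n : ℕ} (f g h : Matrix (Fin n) (Fin n) ℍ[ℝ] →ₗ[ℝ] ℝ)
    {u w : Fin n → ℍ[ℝ]} {a b m : ℝ}
    (hfu : f (outer u) = a) (hfw : f (outer w) = a)
    (hgu : g (outer u) = b) (hgw : g (outer w) = b)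
    (hu : m < h (outer u)) (hw : h (outer w) < m) :
    ∃ x y : Fin n → ℍ[ℝ], outer x + outer y = outer u + outer w ∧
      f (outer x) = a ∧ g (outer x) = b ∧ h (outer x) = m := by
  obtain ⟨p, hp0, hfp, hgp⟩ :=
    exists_ne_zero_of_two_functionals (f ∘ₗ crossTerm u w) (g ∘ₗ crossTerm u w)
  rw [LinearMap.comp_apply] at hfp hgp
  have hp : 0 < normSq p := lt_of_le_of_ne normSq_nonneg (Ne.symm (normSq_ne_zero.mpr hp0))
  obtain ⟨t, ht⟩ := exists_quadratic_root (b := h (crossTerm u w p))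
    (mul_neg_of_pos_of_neg hp (sub_neg.mpr hw)) (sub_pos.mpr hu)
  set q : ℍ[ℝ] := t • p
  have hct : crossTerm u w q = t • crossTerm u w p := map_smul _ t p
  have hpos : (0 : ℝ) < 1 + normSq q := by linarith [normSq_nonneg (a := q)]
  have hnq : normSq q = t ^ 2 * normSq p := normSq_smul t p
  set c : ℝ := (Real.sqrt (1 + normSq q))⁻¹
  have hc : c ^ 2 = (1 + normSq q)⁻¹ := by rw [inv_pow, Real.sq_sqrt hpos.le]
  have key : ∀ (φ : Matrix (Fin n) (Fin n) ℍ[ℝ] →ₗ[ℝ] ℝ) (s : ℝ),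
      φ (outer u) + normSq q * φ (outer w) + t * φ (crossTerm u w p) = s * (1 + normSq q) →
      φ (outer (c • fun i => u i + w i * q)) = s := by
    intro φ s hs
    rw [outer_smul, outer_add_mul, hc, φ.map_smul, map_add, map_add, φ.map_smul, hct, φ.map_smul,
      smul_eq_mul, smul_eq_mul, smul_eq_mul, hs]
    field_simp
  refine ⟨c • fun i => u i + w i * q, c • fun i => w i + u i * (-star q), ?_,
    key f a ?_, key g b ?_, key h m ?_⟩
  · rw [outer_smul, outer_smul, ← smul_add, outer_add_mul, outer_add_mul, crossTerm_swap,
      normSq_neg, normSq_star, hc, inv_smul_eq_iff₀ hpos.ne']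
    module
  · rw [hfu, hfw, hfp]; ring
  · rw [hgu, hgw, hgp]; ring
  · rw [hnq]; linarith

lemma Finset.sum_update_update {ι α M : Type*} [Fintype ι] [DecidableEq ι] [AddCommMonoid M]
    (F : α → M) (v : ι → α) {i j : ι} (hij : i ≠ j) {x y : α}
    (h : F x + F y = F (v i) + F (v j)) :
    ∑ k, F (Function.update (Function.update v i x) j y k) = ∑ k, F (v k) := by
  have hj : j ∈ Finset.univ.erase i := by simp [hij.symm]
  rw [← Finset.add_sum_erase _ _ (Finset.mem_univ i), ← Finset.add_sum_erase _ _ hj,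
    ← Finset.add_sum_erase _ (fun k => F (v k)) (Finset.mem_univ i),
    ← Finset.add_sum_erase _ (fun k => F (v k)) hj, ← add_assoc, ← add_assoc, ← h]
  congr 1
  · simp [hij]
  · refine Finset.sum_congr rfl fun k hk => ?_
    simp only [Finset.mem_erase] at hk
    simp [hk.1, hk.2.1]

lemma exists_outer_decomposition {n r : ℕ} (f g h : Matrix (Fin n) (Fin n) ℍ[ℝ] →ₗ[ℝ] ℝ)
    {X : Matrix (Fin n) (Fin n) ℍ[ℝ]} {a b m : ℝ} (hm : h X = r * m)
    (u : Fin r → Fin n → ℍ[ℝ]) (hX : X = ∑ i, outer (u i))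
    (hf : ∀ i, f (outer (u i)) = a) (hg : ∀ i, g (outer (u i)) = b) :
    ∃ v : Fin r → Fin n → ℍ[ℝ], X = ∑ i, outer (v i) ∧
      ∀ i, f (outer (v i)) = a ∧ g (outer (v i)) = b ∧ h (outer (v i)) = m := by
  induction hN : (Finset.univ.filter fun i => h (outer (u i)) ≠ m).card
    using Nat.strong_induction_on generalizing u with
  | _ N ih =>
    by_cases hall : ∀ i, h (outer (u i)) = m
    · exact ⟨u, hX, fun i => ⟨hf i, hg i, hall i⟩⟩
    push Not at hall
    obtain ⟨k, hk⟩ := hall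
    have hsum : ∑ i, (h (outer (u i)) - m) = 0 := by
      rw [Finset.sum_sub_distrib, ← map_sum, ← hX, hm]
      simp
    have hsum' : ∑ i, (m - h (outer (u i))) = 0 := by
      rw [← neg_eq_zero, ← Finset.sum_neg_distrib, ← hsum]
      simp
    obtain ⟨i, -, hi⟩ := Finset.exists_pos_of_sum_zero_of_exists_nonzero _ hsum
      ⟨k, Finset.mem_univ k, sub_ne_zero.mpr hk⟩
    obtain ⟨j, -, hj⟩ := Finset.exists_pos_of_sum_zero_of_exists_nonzero _ hsum'
      ⟨k, Finset.mem_univ k, sub_ne_zero.mpr hk.symm⟩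
    rw [sub_pos] at hi hj
    have hij : i ≠ j := by
      rintro rfl
      exact lt_asymm hi hj
    obtain ⟨x, y, hxy, hfx, hgx, hhx⟩ :=
      exists_pair_rotation f g h (hf i) (hf j) (hg i) (hg j) hi hj
    have hfy : f (outer y) = a := by
      have := congrArg f hxy
      rw [map_add, map_add, hfx, hf, hf] at this
      linarith
    have hgy : g (outer y) = b := by
      have := congrArg g hxy
      rw [map_add, map_add, hgx, hg, hg] at this
      linarith
    refine ih _ ?_ (Function.update (Function.update u i x) j y) ?_ ?_ ?_ rfl
    · rw [← hN]
      apply Finset.card_lt_card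
      rw [Finset.ssubset_iff_of_subset]
      · refine ⟨i, by simpa using hi.ne', by simp [hij, hhx]⟩
      · intro l hl
        simp only [Finset.mem_filter, Finset.mem_univ, true_and] at hl ⊢
        rcases eq_or_ne l j with rfl | hlj
        · exact hj.ne
        rcases eq_or_ne l i with rfl | hli
        · exact hi.ne'
        simpa [hlj, hli] using hl
    · rw [hX, Finset.sum_update_update outer u hij hxy]
    · intro l
      rcases eq_or_ne l j with rfl | hlj
      · simpa using hfy
      rcases eq_or_ne l i with rfl | hli
      · simpa [hlj] using hfx
      simpa [hlj, hli] using hf l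
    · intro l
      rcases eq_or_ne l j with rfl | hlj
      · simpa using hgy
      rcases eq_or_ne l i with rfl | hli
      · simpa [hlj] using hgx
      simpa [hlj, hli] using hg l

/-- From a decomposition with the equal inner product property for two matrices
one can obtain one with the property for three matrices. -/
theorem quaternion_rank_one_decomposition_two_to_three {n r : ℕ} (hr : 1 ≤ r)
    (A₁ A₂ A₃ : Matrix (Fin n) (Fin n) ℍ[ℝ])
    (h₁ : A₁.IsHermitian) (h₂ : A₂.IsHermitian) (h₃ : A₃.IsHermitian)
    (X : Matrix (Fin n) (Fin n) ℍ[ℝ]) (hX : qPSD X) (hrank : qRank X r)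
    (u : Fin r → (Fin n → ℍ[ℝ]))
    (hu : X = ∑ i, vecMulVec (u i) (star (u i)))
    (huA : ∀ i : Fin r,
      qform A₁ (u i) = ((qdot A₁ X / r : ℝ) : ℍ[ℝ]) ∧
      qform A₂ (u i) = ((qdot A₂ X / r : ℝ) : ℍ[ℝ])) :
    ∃ v : Fin r → (Fin n → ℍ[ℝ]),
      X = ∑ i, vecMulVec (v i) (star (v i)) ∧
      ∀ i : Fin r,
        qform A₁ (v i) = ((qdot A₁ X / r : ℝ) : ℍ[ℝ]) ∧
        qform A₂ (v i) = ((qdot A₂ X / r : ℝ) : ℍ[ℝ]) ∧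
        qform A₃ (v i) = ((qdot A₃ X / r : ℝ) : ℍ[ℝ]) := by
  have hr0 : (r : ℝ) ≠ 0 := by positivity
  have hfu : ∀ i, qdotLin A₁ (outer (u i)) = qdot A₁ X / r := fun i =>
    Quaternion.coe_injective ((qform_eq_coe h₁ (u i)).symm.trans (huA i).1)
  have hgu : ∀ i, qdotLin A₂ (outer (u i)) = qdot A₂ X / r := fun i =>
    Quaternion.coe_injective ((qform_eq_coe h₂ (u i)).symm.trans (huA i).2)
  obtain ⟨v, hv, hvA⟩ := exists_outer_decomposition (qdotLin A₁) (qdotLin A₂) (qdotLin A₃)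
    (m := qdot A₃ X / r) (mul_div_cancel₀ _ hr0).symm u hu hfu hgu
  refine ⟨v, hv, fun i => ?_⟩
  obtain ⟨hf, hg, hh⟩ := hvA i
  rw [qdotLin_apply] at hf hg hh
  exact ⟨by rw [qform_eq_coe h₁, hf], by rw [qform_eq_coe h₂, hg], by rw [qform_eq_coe h₃, hh]⟩
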